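/- Let ρ = (ρ_1, ρ_2) ∈ ℝ² be totally irrational, let g ∈ Homeo₀(𝕋¹) have unique minimal set M ⊊ 𝕋¹ and be semi-conjugate to R_{ρ_1} by a continuous surjection φ, and let f(x,y) = (g(x), y + ρ_2 + β(x) mod 1), where β : 𝕋¹ → ℝ is continuous and β(x) = 0 for all x ∈ M. If f is semi-conjugate to R_ρ : 𝕋² → 𝕋², then there exists a semi-conjugacy ψ between f and R_ρ satisfying ψ(x,y) = (φ(x), y) for all (x,y) ∈ M × 𝕋¹. -/

import Mathlib

open Filter Topology Set

noncomputable section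

/-- The circle `𝕋¹ = ℝ/ℤ`. -/
abbrev T1 : Type := AddCircle (1 : ℝ)

/-- The two-torus `𝕋² = 𝕋¹ × 𝕋¹`. -/
abbrev T2 : Type := T1 × T1

/-- Projection `ℝ × ℝ → 𝕋²`. -/
def p2 : ℝ × ℝ → T2 := fun z => ((z.1 : T1), (z.2 : T1))

/-- `G` is a lift of `g : 𝕋¹ → 𝕋¹` commuting with integer translations; together with
`G` being a homeomorphism this encodes `g ∈ Homeo₀(𝕋¹)`. -/
def IsLift1 (G : ℝ ≃ₜ ℝ) (g : T1 → T1) : Prop :=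
  (∀ x : ℝ, ((G x : T1)) = g (x : T1)) ∧ ∀ (x : ℝ) (m : ℤ), G (x + m) = G x + m

/-- `F` is a lift of `f : 𝕋² → 𝕋²` commuting with integer translations; together with
`F` being a homeomorphism this encodes `f ∈ Homeo₀(𝕋²)`. -/
def IsLift2 (F : (ℝ × ℝ) ≃ₜ (ℝ × ℝ)) (f : T2 → T2) : Prop :=
  (∀ z : ℝ × ℝ, p2 (F z) = f (p2 z)) ∧
  ∀ (z : ℝ × ℝ) (m k : ℤ), F (z + ((m : ℝ), (k : ℝ))) = F z + ((m : ℝ), (k : ℝ))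

/-- `ρ = (ρ₁, ρ₂)` is totally irrational: `1, ρ₁, ρ₂` are linearly independent over `ℚ`. -/
def TotIrr2 (ρ : ℝ × ℝ) : Prop :=
  ∀ a b c : ℤ, (a : ℝ) * ρ.1 + (b : ℝ) * ρ.2 = (c : ℝ) → a = 0 ∧ b = 0

/-- `ψ` is a semi-conjugacy from `f` to `g` (a continuous surjection intertwining them). -/
def Semiconj1 (ψ : T1 → T1) (f g : T1 → T1) : Prop :=
  Continuous ψ ∧ Function.Surjective ψ ∧ ψ ∘ f = g ∘ ψ

/-- `ψ` is a semi-conjugacy from `f` to `g` (a continuous surjection intertwining them). -/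
def Semiconj2 (ψ : T2 → T2) (f g : T2 → T2) : Prop :=
  Continuous ψ ∧ Function.Surjective ψ ∧ ψ ∘ f = g ∘ ψ

/-- The rotation `R_a : 𝕋¹ → 𝕋¹`. -/
def R1 (a : ℝ) : T1 → T1 := fun x => x + (a : T1)

/-- The rotation `R_ρ : 𝕋² → 𝕋²`. -/
def R2 (ρ : ℝ × ℝ) : T2 → T2 := fun z => (z.1 + (ρ.1 : T1), z.2 + (ρ.2 : T1))

/-- `M` is a minimal set of `h`: nonempty, closed, invariant, with no proper nonempty
closed invariant subset. -/
def IsMinimalSet {α : Type*} [TopologicalSpace α] (h : α → α) (M : Set α) : Prop :=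
  M.Nonempty ∧ IsClosed M ∧ h '' M ⊆ M ∧
    ∀ M' ⊆ M, M'.Nonempty → IsClosed M' → h '' M' ⊆ M' → M' = M


lemma aux_lift {A : Type*} [TopologicalSpace A] [SimplyConnectedSpace A]
    [LocallyPathConnectedSpace A] (a₀ : A) (h : A → T1) (hh : Continuous h) :
    ∃ H : A → ℝ, Continuous H ∧ ∀ a, ((H a : ℝ) : T1) = h a := by
  obtain ⟨e₀, he⟩ := QuotientAddGroup.mk_surjective (h a₀)
  obtain ⟨F, ⟨_, hF⟩, _⟩ := (AddCircle.isCoveringMap_coe (1 : ℝ)).existsUnique_continuousMap_lifts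
    (⟨h, hh⟩ : C(A, T1)) a₀ e₀ he
  exact ⟨F, F.continuous, fun a => congrFun hF a⟩

lemma aux_int {A : Type*} [TopologicalSpace A] [PreconnectedSpace A] [Nonempty A]
    (H K : A → ℝ) (hH : Continuous H) (hK : Continuous K)
    (h : ∀ a, ((H a : ℝ) : T1) = ((K a : ℝ) : T1)) : ∃ n : ℤ, ∀ a, H a = K a + n := by
  have h1 : ∀ a, ∃ n : ℤ, (n : ℝ) = H a - K a := by
    intro a
    have : ((H a - K a : ℝ) : T1) = 0 := by
      rw [AddCircle.coe_sub, h a, sub_self]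
    obtain ⟨n, hn⟩ := (AddCircle.coe_eq_zero_iff (1 : ℝ)).1 this
    exact ⟨n, by simpa using hn⟩
  choose n hn using h1
  have hc : Continuous n := by
    rw [Int.isClosedEmbedding_coe_real.isEmbedding.continuous_iff]
    have : ((fun k : ℤ => (k : ℝ)) ∘ n) = fun a => H a - K a := funext hn
    exact this ▸ hH.sub hK
  obtain ⟨a₀⟩ := ‹Nonempty A›
  refine ⟨n a₀, fun a => ?_⟩
  have := PreconnectedSpace.constant ‹_› hc (x := a) (y := a₀)
  rw [← this, hn]; ring

lemma aux_bdd (W : ℝ × ℝ → ℝ) (hW : Continuous W) (h1 : ∀ x y, W (x + 1, y) = W (x, y))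
    (h2 : ∀ x y, W (x, y + 1) = W (x, y)) : ∃ C, ∀ z, |W z| ≤ C := by
  obtain ⟨C, hC⟩ := ((isCompact_Icc (a := (0 : ℝ)) (b := 1)).prod
    (isCompact_Icc (a := (0 : ℝ)) (b := 1))).exists_bound_of_continuousOn hW.continuousOn
  refine ⟨C, fun ⟨x, y⟩ => ?_⟩
  have e1 : W (x, y) = W (Int.fract x, y) := by
    have : Function.Periodic (fun x => W (x, y)) 1 := fun x => h1 x y
    have := this.sub_zsmul_eq (x := x) ⌊x⌋
    simp only [zsmul_eq_mul, mul_one] at this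
    exact this.symm
  have e2 : W (Int.fract x, y) = W (Int.fract x, Int.fract y) := by
    have : Function.Periodic (fun y => W (Int.fract x, y)) 1 := fun y => h2 _ y
    have := this.sub_zsmul_eq (x := y) ⌊y⌋
    simp only [zsmul_eq_mul, mul_one] at this
    exact this.symm
  rw [e1, e2]
  exact hC _ ⟨⟨Int.fract_nonneg _, (Int.fract_lt_one _).le⟩,
    ⟨Int.fract_nonneg _, (Int.fract_lt_one _).le⟩⟩

lemma aux_drift (c C : ℝ) (h : ∀ n : ℕ, |(n : ℝ) * c| ≤ C) : c = 0 := by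
  by_contra hc
  have hp : 0 < |c| := abs_pos.2 hc
  obtain ⟨n, hn⟩ := exists_nat_gt (C / |c|)
  have := h n
  rw [abs_mul, Nat.abs_cast] at this
  rw [div_lt_iff₀ hp] at hn
  linarith

/-- **Lemma (fibred semi-conjugacies, (b)).** Let `ρ` be totally irrational, `g ∈
Homeo₀(𝕋¹)` with unique minimal set `M ⊊ 𝕋¹` semi-conjugate to `R_{ρ₁}` by `φ`, and let
`f(x,y) = (g(x), y + ρ₂ + β(x))` with `β` continuous and vanishing on `M`. If `f` is
semi-conjugate to `R_ρ`, then there is a semi-conjugacy `ψ` with `ψ(x,y) = (φ(x), y)`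
for all `(x,y) ∈ M × 𝕋¹`. -/
theorem exists_semiconjugacy_identity_on_minimal_fibres (ρ : ℝ × ℝ) (hρ : TotIrr2 ρ)
    (g : T1 → T1) (G : ℝ ≃ₜ ℝ) (hg : IsLift1 G g)
    (M : Set T1) (hM : IsMinimalSet g M) (hMuniq : ∀ M' : Set T1, IsMinimalSet g M' → M' = M)
    (hMproper : M ≠ Set.univ)
    (φ : T1 → T1) (hφ : Semiconj1 φ g (R1 ρ.1))
    (β : T1 → ℝ) (hβc : Continuous β) (hβ0 : ∀ x ∈ M, β x = 0)
    (f : T2 → T2) (hfdef : ∀ z : T2, f z = (g z.1, z.2 + ((ρ.2 + β z.1 : ℝ) : T1)))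
    (hsemi : ∃ ψ : T2 → T2, Semiconj2 ψ f (R2 ρ)) :
    ∃ ψ : T2 → T2, Semiconj2 ψ f (R2 ρ) ∧ ∀ x ∈ M, ∀ y : T1, ψ (x, y) = (φ x, y) := by
  obtain ⟨ψ, hψc, -, hψ⟩ := hsemi
  obtain ⟨hφc, hφs, hφe⟩ := hφ
  obtain ⟨hGg, -⟩ := id hg
  have hG1 : ∀ x : ℝ, G (x + 1) = G x + 1 := fun x => by simpa using hg.2 x 1
  have hcoe : Continuous ((↑) : ℝ → T1) := AddCircle.continuous_mk' 1
  have hone : ((1 : ℝ) : T1) = 0 := AddCircle.coe_period 1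
  obtain ⟨hMne, hMcl, hMinv, hMmin⟩ := hM
  have hgc : Continuous g := by
    have : Continuous (g ∘ ((↑) : ℝ → T1)) := by
      have e : (g ∘ ((↑) : ℝ → T1)) = fun x => ((G x : ℝ) : T1) := funext fun x => (hGg x).symm
      rw [e]; exact hcoe.comp G.continuous
    exact (QuotientAddGroup.isQuotientMap_mk _).continuous_iff.2 this
  -- lifts
  obtain ⟨Φ, hΦc, hΦ⟩ := aux_lift (0 : ℝ) (fun x : ℝ => φ (x : T1)) (hφc.comp hcoe)
  obtain ⟨Ψ, hΨc, hΨ⟩ := aux_lift (0 : ℝ × ℝ) (fun z : ℝ × ℝ => (ψ ((z.1 : T1), (z.2 : T1))).2)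
    (by fun_prop)
  have hβR : Continuous fun x : ℝ => β (x : T1) := hβc.comp hcoe
  obtain ⟨k, hk⟩ := aux_int (fun x => Φ (x + 1)) Φ (by fun_prop) hΦc
    (fun x => by simp only [hΦ, AddCircle.coe_add, hone, add_zero])
  obtain ⟨m, hm⟩ := aux_int (fun x => Φ (G x)) (fun x => Φ x + ρ.1)
    (hΦc.comp G.continuous) (by fun_prop)
    (fun x => by
      have := congrFun hφe (x : T1)
      simp only [Function.comp, R1] at this
      simp only [hΦ, AddCircle.coe_add, hGg, this])
  obtain ⟨a, ha⟩ := aux_int (fun z : ℝ × ℝ => Ψ (z.1 + 1, z.2)) Ψ (by fun_prop) hΨc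
    (fun z => by simp only [hΨ, AddCircle.coe_add, hone, add_zero])
  obtain ⟨b, hb⟩ := aux_int (fun z : ℝ × ℝ => Ψ (z.1, z.2 + 1)) Ψ (by fun_prop) hΨc
    (fun z => by simp only [hΨ, AddCircle.coe_add, hone, add_zero])
  obtain ⟨c, hc⟩ := aux_int (fun z : ℝ × ℝ => Ψ (G z.1, z.2 + (ρ.2 + β (z.1 : T1))))
    (fun z => Ψ z + ρ.2)
    (hΨc.comp ((G.continuous.comp continuous_fst).prodMk
      (continuous_snd.add (continuous_const.add (hβR.comp continuous_fst))))) (by fun_prop)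
    (fun z => by
      have := congrArg Prod.snd (congrFun hψ ((z.1 : T1), (z.2 : T1)))
      simp only [Function.comp, R2, hfdef] at this
      simp only [hΨ, AddCircle.coe_add, hGg] at this ⊢
      exact this)
  -- an orbit in the minimal set
  obtain ⟨p, hp⟩ := hMne
  obtain ⟨x0, rfl⟩ := QuotientAddGroup.mk_surjective p
  change ((x0 : ℝ) : T1) ∈ M at hp
  let X : ℕ → ℝ := fun n => G^[n] x0
  have hXs : ∀ n, X (n + 1) = G (X n) := fun n => Function.iterate_succ_apply' _ _ _
  have hXM : ∀ n, ((X n : ℝ) : T1) ∈ M := by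
    intro n
    induction n with
    | zero => exact hp
    | succ n ih => rw [hXs, hGg]; exact hMinv ⟨_, ih, rfl⟩
  have hΦX : ∀ n : ℕ, Φ (X n) = Φ x0 + n * (ρ.1 + m) := by
    intro n
    induction n with
    | zero => simp [X]
    | succ n ih => rw [hXs, hm, ih]; push_cast; ring
  have hΨX : ∀ n : ℕ, Ψ (X n, n * ρ.2) = Ψ (x0, 0) + n * (ρ.2 + c) := by
    intro n
    induction n with
    | zero => simp [X]
    | succ n ih =>
      have := hc (X n, n * ρ.2)
      simp only [hβ0 _ (hXM n), add_zero] at this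
      rw [hXs]
      have e : (((n + 1 : ℕ) : ℝ) * ρ.2) = n * ρ.2 + ρ.2 := by push_cast; ring
      rw [e, this, ih]; push_cast; ring
  obtain ⟨C1, hC1⟩ := aux_bdd (fun z => Φ z.1 - k * z.1) (by fun_prop)
    (fun x y => by simp only [hk]; ring) (fun x y => rfl)
  obtain ⟨C2, hC2⟩ := aux_bdd (fun z => Ψ z - a * z.1 - b * z.2) (by fun_prop)
    (fun x y => by have := ha (x, y); simp only at this ⊢; rw [this]; ring)
    (fun x y => by have := hb (x, y); simp only at this ⊢; rw [this]; ring)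
  have hk0 : k ≠ 0 := by
    intro h0
    have : ρ.1 + m = 0 := by
      apply aux_drift _ (C1 + |Φ x0|)
      intro n
      have h1 := hC1 (X n, 0)
      simp only [hΦX, h0, Int.cast_zero, zero_mul, sub_zero] at h1
      have e : (n : ℝ) * (ρ.1 + m) = (Φ x0 + n * (ρ.1 + m)) - Φ x0 := by ring
      rw [e]
      exact (abs_sub _ _).trans (by linarith)
    have := hρ 1 0 (-m) (by push_cast; linarith)
    exact one_ne_zero this.1
  have hlin : k * (ρ.2 + c) - a * (ρ.1 + m) - k * b * ρ.2 = 0 := by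
    apply aux_drift _ (|(k : ℝ)| * C2 + |(a : ℝ)| * C1 + |a * Φ x0 - k * Ψ (x0, 0)|)
    intro n
    have h1 := hC1 (X n, 0)
    have h2 := hC2 (X n, n * ρ.2)
    simp only [hΦX, hΨX] at h1 h2
    have e : (n : ℝ) * (k * (ρ.2 + c) - a * (ρ.1 + m) - k * b * ρ.2)
        = k * (Ψ (x0, 0) + n * (ρ.2 + c) - a * X n - b * (n * ρ.2))
          + (-a) * (Φ x0 + n * (ρ.1 + m) - k * X n) + (a * Φ x0 - k * Ψ (x0, 0)) := by ring
    rw [e]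
    refine (abs_add_three _ _ _).trans ?_
    rw [abs_mul, abs_mul, abs_neg]
    gcongr
  have hab := hρ (-a) (k * (1 - b)) (a * m - k * c) (by push_cast; linarith)
  have ha0 : a = 0 := by simpa using hab.1
  have hb1 : b = 1 := by
    rcases mul_eq_zero.1 hab.2 with h | h
    · exact absurd h hk0
    · omega
  subst ha0 hb1
  -- averaging over the fibre
  let u : ℝ → ℝ := fun x => ∫ y in (0 : ℝ)..1, (Ψ (x, y) - y)
  have huc : Continuous u :=
    intervalIntegral.continuous_parametric_intervalIntegral_of_continuous' (by fun_prop) _ _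
  have hup : Function.Periodic u 1 := by
    intro x
    refine intervalIntegral.integral_congr fun y _ => ?_
    have := ha (x, y)
    simp only [Int.cast_zero, add_zero] at this
    simp only [this]
  have hcob : ∀ x, u (G x) + β (x : T1) = u x + c := by
    intro x
    have hper : Function.Periodic (fun y => Ψ (G x, y) - y) 1 := by
      intro y
      have := hb (G x, y)
      simp only [Int.cast_one] at this
      simp only [this]; ring
    have h1 : u (G x) = ∫ y in (0 : ℝ)..1,
        (Ψ (G x, y + (ρ.2 + β (x : T1))) - (y + (ρ.2 + β (x : T1)))) := by
      rw [intervalIntegral.integral_comp_add_right (fun y => Ψ (G x, y) - y)]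
      have := hper.intervalIntegral_add_eq 0 (ρ.2 + β (x : T1))
      rw [zero_add] at this
      simp only [u, this, zero_add]
      rw [add_comm (1 : ℝ)]
    have h2 : ∀ y, (Ψ (G x, y + (ρ.2 + β (x : T1))) - (y + (ρ.2 + β (x : T1))))
        = (Ψ (x, y) - y) + (c - β (x : T1)) := by
      intro y
      have := hc (x, y)
      simp only at this
      rw [this]; ring
    simp only [h2] at h1
    rw [intervalIntegral.integral_add
      (Continuous.intervalIntegrable (by fun_prop) _ _) (by simp)] at h1
    rw [h1]; simp only [intervalIntegral.integral_const, sub_zero, one_smul, u]; ring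
  obtain ⟨C3, hC3⟩ := aux_bdd (fun z => u z.1) (by fun_prop) (fun x y => hup x) (fun x y => rfl)
  have hc0 : (c : ℝ) = 0 := by
    have huX : ∀ n : ℕ, u (X n) = u x0 + n * c := by
      intro n
      induction n with
      | zero => simp [X]
      | succ n ih =>
        have := hcob (X n)
        rw [hβ0 _ (hXM n), add_zero, ih] at this
        rw [hXs, this]; push_cast; ring
    apply aux_drift _ (C3 + |u x0|)
    intro n
    have h1 := hC3 (X n, 0)
    simp only [huX] at h1
    have e : (n : ℝ) * c = (u x0 + n * c) - u x0 := by ring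
    rw [e]
    exact (abs_sub _ _).trans (by linarith)
  -- descend to the circle
  let U : T1 → ℝ := hup.lift
  have hU : ∀ x : ℝ, U (x : T1) = u x := fun x => hup.lift_coe x
  have hUc : Continuous U := by
    refine (QuotientAddGroup.isQuotientMap_mk _).continuous_iff.2 ?_
    have e : (U ∘ ((↑) : ℝ → T1)) = u := funext hU
    exact e ▸ huc
  have hUcob : ∀ x : T1, U (g x) + β x = U x := by
    intro x
    obtain ⟨x, rfl⟩ := QuotientAddGroup.mk_surjective x
    change U (g (x : T1)) + β (x : T1) = U (x : T1)
    rw [← hGg, hU, hU, hcob, hc0, add_zero]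
  have hUM : ∀ x ∈ M, U x = u x0 := by
    have hS : M ∩ {x | U x = u x0} = M := by
      refine hMmin _ inter_subset_left ⟨_, hp, hU x0⟩
        (hMcl.inter (isClosed_eq hUc continuous_const)) ?_
      rintro _ ⟨x, ⟨hxM, hx⟩, rfl⟩
      refine ⟨hMinv ⟨x, hxM, rfl⟩, ?_⟩
      have := hUcob x
      rw [hβ0 x hxM, add_zero] at this
      exact this.trans hx
    intro x hx
    rw [← hS] at hx
    exact hx.2
  refine ⟨fun z => (φ z.1, z.2 + ((U z.1 - u x0 : ℝ) : T1)), ⟨?_, ?_, ?_⟩, ?_⟩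
  · exact (hφc.comp continuous_fst).prodMk
      (continuous_snd.add (hcoe.comp ((hUc.comp continuous_fst).sub continuous_const)))
  · rintro ⟨s, t⟩
    obtain ⟨x, rfl⟩ := hφs s
    exact ⟨(x, t - ((U x - u x0 : ℝ) : T1)), by simp⟩
  · funext z
    have h1 := congrFun hφe z.1
    simp only [Function.comp, R1] at h1
    simp only [Function.comp, R2, hfdef, h1]
    refine Prod.ext rfl ?_
    simp only [← hUcob z.1, AddCircle.coe_add, AddCircle.coe_sub]
    abel
  · intro x hx y
    simp [hUM x hx]

end
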